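/- Let σ₁ > σ₂ > 0, a > 0 and μ > 0 be real numbers, and define p* = max(0, (−(σ₁+σ₂) + √((σ₁−σ₂)² + 4(σ₁−σ₂)σ₁σ₂/(μa))) / (2σ₁σ₂)). Then p* maximizes the function g(p) = log(1+σ₁p) − log(1+σ₂p) − μ·a·p over p ∈ [0,∞); that is, for every real p ≥ 0, log(1+σ₁p) − log(1+σ₂p) − μap ≤ log(1+σ₁p*) − log(1+σ₂p*) − μap*. -/

import Mathlib

/-- Tangent-line bound at `q` for the concave function `p ↦ log (1 + s * p) - log (1 + t * p)`. -/
theorem log_sub_log_sub_le_tangent {s t p q : ℝ} (ht : 0 ≤ t) (hst : t ≤ s) (hp : 0 ≤ p)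
    (hq : 0 ≤ q) :
    (Real.log (1 + s * p) - Real.log (1 + t * p)) -
        (Real.log (1 + s * q) - Real.log (1 + t * q)) ≤
      (s - t) * (p - q) / ((1 + s * q) * (1 + t * q)) := by
  have hs : 0 ≤ s := ht.trans hst
  have hsp : 0 < 1 + s * p := by positivity
  have htp : 0 < 1 + t * p := by positivity
  have hsq : 0 < 1 + s * q := by positivity
  have htq : 0 < 1 + t * q := by positivity
  have hlog := Real.log_le_sub_one_of_pos
    (show 0 < (1 + s * p) * (1 + t * q) / ((1 + t * p) * (1 + s * q)) by positivity)
  rw [Real.log_div (by positivity) (by positivity), Real.log_mul hsp.ne' htq.ne',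
    Real.log_mul htp.ne' hsq.ne'] at hlog
  have hgap : (s - t) * (p - q) / ((1 + s * q) * (1 + t * q)) -
      ((1 + s * p) * (1 + t * q) / ((1 + t * p) * (1 + s * q)) - 1) =
      (s - t) * t * (p - q) ^ 2 / ((1 + s * q) * (1 + t * q) * (1 + t * p)) := by
    field_simp
    ring
  have hgap_nonneg :
      0 ≤ (s - t) * t * (p - q) ^ 2 / ((1 + s * q) * (1 + t * q) * (1 + t * p)) :=
    div_nonneg (mul_nonneg (mul_nonneg (sub_nonneg.2 hst) ht) (sq_nonneg _)) (by positivity)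
  linarith

/-- The stationarity equation `(1 + s * r) * (1 + t * r) = k` solved by the quadratic formula. -/
theorem one_add_mul_mul_one_add_mul_eq_of_sqrt {s t k : ℝ} (hs : 0 < s) (ht : 0 < t)
    (hk : 0 ≤ k) :
    let r := (-(s + t) + Real.sqrt ((s - t) ^ 2 + 4 * k * s * t)) / (2 * s * t)
    (1 + s * r) * (1 + t * r) = k := by
  intro r
  have hsqrt : Real.sqrt ((s - t) ^ 2 + 4 * k * s * t) = 2 * s * t * r + (s + t) := by
    simp only [r]
    field_simp
    ring
  have hsq := Real.sq_sqrt (show 0 ≤ (s - t) ^ 2 + 4 * k * s * t by positivity)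
  rw [hsqrt] at hsq
  have hst : 4 * (s * t) ≠ 0 := by positivity
  apply mul_left_cancel₀ hst
  linear_combination hsq

/-- The closed-form water-filling point
`p* = max(0, (−(σ₁+σ₂) + √((σ₁−σ₂)² + 4(σ₁−σ₂)σ₁σ₂/(μa)))/(2σ₁σ₂))`
maximizes `p ↦ log(1+σ₁p) − log(1+σ₂p) − μap` over `p ∈ [0,∞)`. -/
theorem stmt_15 (σ₁ σ₂ a μ : ℝ) (hσ₂ : 0 < σ₂) (hσ : σ₂ < σ₁) (ha : 0 < a) (hμ : 0 < μ)
    (pstar : ℝ)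
    (hpstar : pstar = max 0
      ((-(σ₁ + σ₂) + Real.sqrt ((σ₁ - σ₂) ^ 2 + 4 * (σ₁ - σ₂) * σ₁ * σ₂ / (μ * a))) /
        (2 * σ₁ * σ₂))) :
    ∀ p : ℝ, 0 ≤ p →
      Real.log (1 + σ₁ * p) - Real.log (1 + σ₂ * p) - μ * a * p ≤
        Real.log (1 + σ₁ * pstar) - Real.log (1 + σ₂ * pstar) - μ * a * pstar := by
  intro p hp
  have hσ₁ : 0 < σ₁ := hσ₂.trans hσ
  have hc : 0 < μ * a := mul_pos hμ ha
  have hk : 0 ≤ (σ₁ - σ₂) / (μ * a) := div_nonneg (sub_nonneg.2 hσ.le) hc.le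
  have hroot := one_add_mul_mul_one_add_mul_eq_of_sqrt hσ₁ hσ₂ hk
  rw [show (σ₁ - σ₂) ^ 2 + 4 * ((σ₁ - σ₂) / (μ * a)) * σ₁ * σ₂ =
    (σ₁ - σ₂) ^ 2 + 4 * (σ₁ - σ₂) * σ₁ * σ₂ / (μ * a) by ring] at hroot
  have hnonneg_add : 0 ≤ 1 + σ₁ * ((-(σ₁ + σ₂) + Real.sqrt ((σ₁ - σ₂) ^ 2 +
      4 * (σ₁ - σ₂) * σ₁ * σ₂ / (μ * a))) / (2 * σ₁ * σ₂)) := by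
    have hle : σ₁ - σ₂ ≤ Real.sqrt ((σ₁ - σ₂) ^ 2 +
        4 * (σ₁ - σ₂) * σ₁ * σ₂ / (μ * a)) := by
      apply Real.le_sqrt_of_sq_le
      have := sub_pos.2 hσ
      have : 0 ≤ 4 * (σ₁ - σ₂) * σ₁ * σ₂ / (μ * a) := by positivity
      linarith
    rw [show ∀ x : ℝ, 1 + σ₁ * ((-(σ₁ + σ₂) + x) / (2 * σ₁ * σ₂)) =
      (x - (σ₁ - σ₂)) / (2 * σ₂) by intro x; field_simp; ring]
    exact div_nonneg (sub_nonneg.2 hle) (by positivity)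
  dsimp only at hroot
  generalize (-(σ₁ + σ₂) + Real.sqrt ((σ₁ - σ₂) ^ 2 +
    4 * (σ₁ - σ₂) * σ₁ * σ₂ / (μ * a))) / (2 * σ₁ * σ₂) = r at hpstar hroot hnonneg_add
  rw [eq_div_iff hc.ne'] at hroot
  have hq : 0 ≤ pstar := hpstar ▸ le_max_left _ _
  have htangent := log_sub_log_sub_le_tangent hσ₂.le hσ.le hp hq
  have hslope : (σ₁ - σ₂) * (p - pstar) / ((1 + σ₁ * pstar) * (1 + σ₂ * pstar)) ≤
      μ * a * (p - pstar) := by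
    rw [div_le_iff₀ (by positivity)]
    rcases le_total 0 r with hr | hr
    · rw [max_eq_right hr] at hpstar
      subst hpstar
      exact le_of_eq (by linear_combination -(p - pstar) * hroot)
    · rw [max_eq_left hr] at hpstar
      subst hpstar
      have hprod : (1 + σ₁ * r) * (1 + σ₂ * r) ≤ 1 := by
        have h₁ : σ₁ * r ≤ 0 := mul_nonpos_of_nonneg_of_nonpos hσ₁.le hr
        have h₂ : σ₂ * r ≤ 0 := mul_nonpos_of_nonneg_of_nonpos hσ₂.le hr
        nlinarith
      have hle : σ₁ - σ₂ ≤ μ * a := by nlinarith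
      simpa using mul_le_mul_of_nonneg_right hle hp
  linarith
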